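/- For every positive integer n and every integer k ≥ 1, the only positive integers x, y, z satisfying ((F_k − 2)n)^x + (2^{2^{k−1}+1} n)^y = (F_k n)^z are (x, y, z) = (2, 2, 2), where F_k = 2^(2^k) + 1. -/

import Mathlib

/-- If `4 d (w + d)` is divisible by a power of two with `w` odd, all but a factor `4` of that
power divides one of the two factors. -/
lemma two_pow_dvd_of_dvd_mul {e d w : ℕ} (hw : Odd w) (h : 2 ^ e ∣ 4 * (d * (w + d))) :
    2 ^ e ∣ 4 * d ∨ 2 ^ e ∣ 4 * (w + d) := by
  rcases Nat.even_or_odd d with hd | hd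
  · left
    have ho : Odd (w + d) := hw.add_even hd
    have hc : Nat.Coprime (2 ^ e) (w + d) := (Nat.coprime_two_left.2 ho).pow_left _
    exact hc.dvd_of_dvd_mul_right (by rwa [mul_assoc])
  · right
    have hc : Nat.Coprime (2 ^ e) d := (Nat.coprime_two_left.2 hd).pow_left _
    refine hc.dvd_of_dvd_mul_left (n := 4 * (w + d)) ?_
    convert h using 1; ring

lemma exists_add_two_mul_of_sq_lt {C w : ℕ} (hC : Odd C) (hw : Odd w) (h : w ^ 2 < C ^ 2) :
    ∃ d, 0 < d ∧ C = w + 2 * d := by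
  have hlt : w < C := lt_of_pow_lt_pow_left₀ 2 (Nat.zero_le _) h
  obtain ⟨p, rfl⟩ := hC
  obtain ⟨q, rfl⟩ := hw
  exact ⟨p - q, by omega, by omega⟩

lemma odd_sq_add_one {m : ℕ} (hm : Even m) : Odd (m ^ 2 + 1) :=
  (hm.pow_of_ne_zero two_ne_zero).add_one

lemma square_add_mul_ne {M m w y Z N : ℕ} (hM : 0 < M) (hm : m = 2 ^ M) (hw : Odd w)
    (hN : 0 < N) (hZ : 0 < Z) (hy : 2 * Z < y) :
    w ^ 2 + (2 * m) ^ y * N ≠ (m ^ 2 + 1) ^ (2 * Z) := by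
  intro h
  have hm2 : 2 ≤ m := hm ▸ Nat.le_self_pow hM.ne' 2
  have hme : Even m := hm ▸ (even_two.pow_of_ne_zero hM.ne')
  have hC : Odd ((m ^ 2 + 1) ^ Z) := (odd_sq_add_one hme).pow
  rw [mul_comm 2 Z, pow_mul] at h
  have hpos : 0 < (2 * m) ^ y * N := by positivity
  obtain ⟨d, hd, hCd⟩ := exists_add_two_mul_of_sq_lt hC hw (by omega)
  have hprod : (2 * m) ^ y * N = 4 * (d * (w + d)) := by
    rw [hCd] at h; nlinarith
  have hpow : (2 * m) ^ y = 2 ^ ((M + 1) * y) := by rw [hm, pow_mul, pow_succ']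
  have hle : (2 * m) ^ y ≤ 4 * (m ^ 2 + 1) ^ Z := by
    rw [hCd]
    rcases two_pow_dvd_of_dvd_mul (e := (M + 1) * y) (d := d) hw
      (hpow ▸ hprod ▸ dvd_mul_right _ _) with h1 | h1
    · have := Nat.le_of_dvd (by positivity) h1
      omega
    · have := Nat.le_of_dvd (by positivity) h1
      omega
  have h1 : (m ^ 2 + 1) ^ Z < ((2 * m) ^ 2) ^ Z :=
    Nat.pow_lt_pow_left (by nlinarith) hZ.ne'
  have h2 : (2 * m) ^ (2 * Z + 1) ≤ (2 * m) ^ y := Nat.pow_le_pow_right (by omega) hy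
  rw [pow_succ, pow_mul] at h2
  nlinarith

lemma eq_one_of_pow_two_pow_eq_one {G : Type*} [Monoid G] {g : G} {L i : ℕ} (hi : Odd i)
    (h1 : g ^ 2 ^ L = 1) (h2 : g ^ i = 1) : g = 1 := by
  have hc : Nat.gcd (2 ^ L) i = 1 := (Nat.coprime_two_left.2 hi).pow_left L
  simpa [hc] using pow_gcd_eq_one.2 ⟨h1, h2⟩

/-- The case in which both odd terms are perfect squares. -/
lemma sq_add_two_pow_eq_sq {M m a e X Z : ℕ} (hM : 0 < M) (hm : m = 2 ^ M) (ha : a + 1 = m ^ 2)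
    (h3 : 3 ∣ a) (hZ : 0 < Z) (h : a ^ (2 * X) + 2 ^ e = (m ^ 2 + 1) ^ (2 * Z)) :
    X = 1 ∧ Z = 1 := by
  have hm2 : 2 ≤ m := hm ▸ Nat.le_self_pow hM.ne' 2
  have hme : Even m := hm ▸ (even_two.pow_of_ne_zero hM.ne')
  have hC : Odd ((m ^ 2 + 1) ^ Z) := (odd_sq_add_one hme).pow
  have hao : Odd a := by
    have : Even (a + 1) := ha ▸ hme.pow_of_ne_zero two_ne_zero
    simpa [Nat.even_add_one] using this
  rw [mul_comm 2 Z, mul_comm 2 X, pow_mul, pow_mul] at h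
  have hpos : 0 < 2 ^ e := by positivity
  obtain ⟨d, hd, hCd⟩ := exists_add_two_mul_of_sq_lt hC (hao.pow (n := X)) (by omega)
  have hprod : 2 ^ e = 4 * (d * (a ^ X + d)) := by
    rw [hCd] at h; nlinarith
  have haX : 0 < a ^ X := hao.pow.pos
  obtain ⟨i, -, hi⟩ := (Nat.dvd_prime_pow Nat.prime_two (m := e) (i := d)).1
    (hprod ▸ Dvd.intro (4 * (a ^ X + d)) (by ring))
  obtain ⟨l, -, hl⟩ := (Nat.dvd_prime_pow Nat.prime_two (m := e) (i := a ^ X + d)).1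
    (hprod ▸ Dvd.intro (4 * d) (by ring))
  have hl0 : l ≠ 0 := by rintro rfl; simp at hl; omega
  have hdo : Odd d := by
    have h1 : Even (a ^ X + d) := hl ▸ even_two.pow_of_ne_zero hl0
    by_contra h2
    exact Nat.not_even_iff_odd.2 (hao.pow.add_even (Nat.not_odd_iff_even.1 h2)) h1
  have hd1 : d = 1 := by
    rcases Nat.eq_zero_or_pos i with rfl | h0
    · simpa using hi
    · exact absurd (hi ▸ even_two.pow_of_ne_zero h0.ne') (Nat.not_even_iff_odd.2 hdo)
  subst hd1
  have hc : (m ^ 2 + 1) ^ Z = 2 ^ l + 1 := by omega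
  have hZo : Odd Z := by
    by_contra hZe
    obtain ⟨q, rfl⟩ := Nat.not_odd_iff_even.1 hZe
    have hmod : (m ^ 2 + 1) ≡ 2 [MOD 3] := by
      unfold Nat.ModEq; omega
    have h4 : (m ^ 2 + 1) ^ (q + q) ≡ 1 [MOD 3] := by
      rw [← two_mul, pow_mul]
      simpa using (((hmod.pow 2).trans (show 2 ^ 2 ≡ 1 [MOD 3] from rfl)).pow q)
    rw [hc] at h4
    have h5 : 3 ∣ 2 ^ l := by
      have := (Nat.modEq_iff_dvd' (by omega)).1 h4.symm
      simpa using this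
    have := Nat.prime_three.dvd_of_dvd_pow h5
    omega
  have hZ1 : Z = 1 := by
    obtain ⟨q, rfl⟩ := hZo
    have hsq : (m ^ 2 + 1) ^ 2 ≡ 1 [MOD 2 * m ^ 2] := by
      have : (m ^ 2 + 1) ^ 2 = 1 + 2 * m ^ 2 * (m ^ 2 / 2 + 1) := by
        have h2 : m ^ 2 = 2 * (m ^ 2 / 2) := by
          have := (hme.pow_of_ne_zero two_ne_zero).two_dvd
          omega
        generalize m ^ 2 / 2 = r at h2
        rw [h2]; ring
      rw [this]
      simp [Nat.ModEq]
    have h6 : (m ^ 2 + 1) ^ (2 * q + 1) ≡ m ^ 2 + 1 [MOD 2 * m ^ 2] := by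
      rw [pow_succ _ (2 * q), pow_mul _ 2 q]
      simpa using (hsq.pow q).mul_right (m ^ 2 + 1)
    rw [hc] at h6
    have h7 : 2 ^ l ≡ m ^ 2 [MOD 2 * m ^ 2] := Nat.ModEq.add_right_cancel' 1 h6
    have hmm : 2 * m ^ 2 = 2 ^ (2 * M + 1) := by rw [hm]; ring
    have h8 : l < 2 * M + 1 := by
      by_contra hcon
      have : 2 * m ^ 2 ∣ 2 ^ l := hmm ▸ pow_dvd_pow 2 (by omega)
      have h9 := (h7.dvd_iff dvd_rfl).1 this
      have := Nat.le_of_dvd (by positivity) h9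
      nlinarith
    have h9 : 2 ^ l < 2 * m ^ 2 := hmm ▸ Nat.pow_lt_pow_right (by norm_num) h8
    have h10 : (m ^ 2 + 1) ^ (2 * q + 1) < (m ^ 2 + 1) ^ 2 := by
      rw [hc]; nlinarith
    have := (Nat.pow_lt_pow_iff_right (by nlinarith)).1 h10
    omega
  refine ⟨?_, hZ1⟩
  subst hZ1
  have : a ^ X = a ^ 1 := by
    rw [pow_one] at hc hCd ⊢
    omega
  exact Nat.pow_right_injective (show 2 ≤ a by nlinarith) this

lemma dvd_sub_mul_of_dvd_pow_sub_pow {A u v n : ℕ} (hA : Odd A) (hvu : v < u) (hn : n ≠ 0)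
    (hp : ∀ p, p.Prime → p ∣ A → p ∣ u - v ∧ ¬ p ∣ u) (h : A ∣ u ^ n - v ^ n) :
    A ∣ (u - v) * n := by
  have h0 : u ^ n - v ^ n ≠ 0 := Nat.sub_ne_zero_of_lt (Nat.pow_lt_pow_left hvu hn)
  have h1 : u - v ≠ 0 := Nat.sub_ne_zero_of_lt hvu
  refine (Nat.factorization_prime_le_iff_dvd hA.pos.ne' (mul_ne_zero h1 hn)).1 fun p hpp => ?_
  by_cases hpA : p ∣ A
  · obtain ⟨h2, h3⟩ := hp p hpp hpA
    have := Fact.mk hpp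
    have hle := (Nat.factorization_prime_le_iff_dvd hA.pos.ne' h0).2 h p hpp
    have hlte := padicValNat.pow_sub_pow (hA.of_dvd_nat hpA) hvu h2 h3 hn
    rw [Nat.factorization_def (u ^ n - v ^ n) hpp, hlte, ← padicValNat.mul h1 hn] at hle
    rwa [Nat.factorization_def ((u - v) * n) hpp]
  · simp [Nat.factorization_eq_zero_of_not_dvd hpA]

lemma dvd_add_mul_of_dvd_pow_add_pow {A u v n : ℕ} (hA : Odd A) (hu : 0 < u) (hn : Odd n)
    (hp : ∀ p, p.Prime → p ∣ A → p ∣ u + v ∧ ¬ p ∣ u) (h : A ∣ u ^ n + v ^ n) :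
    A ∣ (u + v) * n := by
  have h0 : u ^ n + v ^ n ≠ 0 := by positivity
  have h1 : u + v ≠ 0 := by positivity
  have hn0 := hn.pos.ne'
  refine (Nat.factorization_prime_le_iff_dvd hA.pos.ne' (mul_ne_zero h1 hn0)).1 fun p hpp => ?_
  by_cases hpA : p ∣ A
  · obtain ⟨h2, h3⟩ := hp p hpp hpA
    have := Fact.mk hpp
    have hle := (Nat.factorization_prime_le_iff_dvd hA.pos.ne' h0).2 h p hpp
    have hlte := padicValNat.pow_add_pow (hA.of_dvd_nat hpA) h2 h3 hn
    rw [Nat.factorization_def (u ^ n + v ^ n) hpp, hlte, ← padicValNat.mul h1 hn0] at hle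
    rwa [Nat.factorization_def ((u + v) * n) hpp]
  · simp [Nat.factorization_eq_zero_of_not_dvd hpA]

lemma even_of_two_pow_modEq_one {z : ℕ} (h : 2 ^ z ≡ 1 [MOD 3]) : Even z := by
  by_contra hz
  obtain ⟨q, rfl⟩ := Nat.not_even_iff_odd.1 hz
  have h1 : 2 ^ (2 * q + 1) ≡ 2 [MOD 3] := by
    rw [pow_succ, pow_mul]
    simpa using ((show 2 ^ 2 ≡ 1 [MOD 3] from rfl).pow q).mul_right 2
  exact absurd (h1.symm.trans h) (by decide)

lemma sq_add_one_modEq_two {m a : ℕ} (ha : a + 1 = m ^ 2) : m ^ 2 + 1 ≡ 2 [MOD a] := by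
  rw [← ha]; simp [Nat.ModEq, add_assoc]

/-- The equation left over when `y < z < x`. -/
lemma mul_pow_add_one_ne {m a x z R : ℕ} (ha : a + 1 = m ^ 2) (h3 : 3 ∣ a) (hz : 0 < z)
    (hzx : z < x) : a ^ x * R + 1 ≠ (m ^ 2 + 1) ^ z := by
  intro h
  have hmod : 2 ^ z ≡ 1 [MOD a] := by
    refine ((sq_add_one_modEq_two ha).pow z).symm.trans ?_
    rw [← h]
    have : a ∣ a ^ x * R := (dvd_pow_self a (by omega)).mul_right R
    simpa using ((Nat.modEq_zero_iff_dvd.2 this).add_right 1)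
  obtain ⟨Z, rfl⟩ := (even_of_two_pow_modEq_one (hmod.of_dvd h3)).two_dvd
  have hZ : 0 < Z := by omega
  have hle : m ^ 2 ≤ 2 ^ (2 * Z) := by
    have h1 := (Nat.modEq_iff_dvd' Nat.one_le_two_pow).1 hmod.symm
    have h2 : 1 < 2 ^ (2 * Z) := Nat.one_lt_two_pow (by omega)
    have := Nat.le_of_dvd (by omega) h1
    omega
  have hsub : (m ^ 2 + 1) ^ 2 - 1 = m ^ 2 * (m ^ 2 + 2) := by
    rw [show (m ^ 2 + 1) ^ 2 = m ^ 2 * (m ^ 2 + 2) + 1 by ring]; rfl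
  have hm3 : ¬ 3 ∣ m ^ 2 := by omega
  have hdvd : 3 ^ x ∣ ((m ^ 2 + 1) ^ 2 - 1) * Z := by
    refine dvd_sub_mul_of_dvd_pow_sub_pow (Odd.pow (by decide)) (by nlinarith) hZ.ne'
      (fun p hp hp3 => ?_) ?_
    · obtain rfl := (Nat.prime_dvd_prime_iff_eq hp Nat.prime_three).1 (hp.dvd_of_dvd_pow hp3)
      refine ⟨hsub ▸ Dvd.dvd.mul_left (by omega) _, fun h' => ?_⟩
      have := Nat.prime_three.dvd_of_dvd_pow h'
      omega
    · rw [← pow_mul, one_pow, ← h]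
      simpa using ((pow_dvd_pow_of_dvd h3 x).mul_right R)
  rw [hsub, mul_assoc] at hdvd
  have hcop : Nat.Coprime (3 ^ x) (m ^ 2) :=
    ((Nat.prime_three.coprime_iff_not_dvd).2 hm3).pow_left x
  have h4 := Nat.le_of_dvd (by positivity) (hcop.dvd_of_dvd_mul_left hdvd)
  have h5 : 3 ^ (2 * Z + 1) ≤ 3 ^ x := Nat.pow_le_pow_right (by norm_num) hzx
  have h6 : ∀ Z : ℕ, (2 ^ (2 * Z) + 2) * Z < 3 ^ (2 * Z + 1) := by
    intro Z
    have h7 : Z < 2 ^ Z := Nat.lt_two_pow_self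
    have h8 : 2 ^ (2 * Z) * Z ≤ 3 ^ (2 * Z) := by
      calc 2 ^ (2 * Z) * Z ≤ 2 ^ (2 * Z) * 2 ^ Z := by gcongr
        _ = 8 ^ Z := by rw [← pow_add, show 2 * Z + Z = 3 * Z by ring, pow_mul]; norm_num
        _ ≤ 9 ^ Z := Nat.pow_le_pow_left (by norm_num) Z
        _ = 3 ^ (2 * Z) := by rw [pow_mul]; norm_num
    have h9 : Z < 3 ^ (2 * Z) :=
      h7.trans_le ((Nat.pow_le_pow_left (by norm_num) Z).trans
        (Nat.pow_le_pow_right (by norm_num) (by omega)))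
    rw [pow_succ]; nlinarith
  have := h6 Z
  nlinarith [Nat.mul_le_mul_right Z (Nat.add_le_add_right hle 2)]

lemma sq_add_sq_eq {m a : ℕ} (ha : a + 1 = m ^ 2) : a ^ 2 + (2 * m) ^ 2 = (m ^ 2 + 1) ^ 2 := by
  rw [mul_pow, ← ha]; ring

lemma odd_of_add_one_eq_sq {m a : ℕ} (hm : Even m) (ha : a + 1 = m ^ 2) : Odd a := by
  have : Even (a + 1) := ha ▸ hm.pow_of_ne_zero two_ne_zero
  simpa [Nat.even_add_one] using this

lemma coprime_sq_add_one {m a : ℕ} (hm : Even m) (ha : a + 1 = m ^ 2) :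
    Nat.Coprime a (m ^ 2 + 1) := by
  have h := odd_of_add_one_eq_sq hm ha
  rw [← ha, show a + 1 + 1 = 2 + a by ring, Nat.coprime_add_self_right]
  exact Nat.coprime_two_right.2 h

/-- The equation left over when `y = z < x`. -/
lemma pow_mul_add_pow_ne {m a x z R : ℕ} (hm : Even m) (hm2 : 2 ≤ m) (ha : a + 1 = m ^ 2)
    (hz : 0 < z) (hzx : z < x) :
    a ^ x * R + (2 * m) ^ z ≠ (m ^ 2 + 1) ^ z := by
  intro h
  have hao := odd_of_add_one_eq_sq hm ha
  have ha3 : 3 ≤ a := by nlinarith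
  have hma : (m + 1) ∣ a := ⟨m - 1, by
    obtain ⟨r, rfl⟩ := Nat.exists_eq_add_of_le' hm2
    simp only [show r + 2 - 1 = r + 1 by omega]
    nlinarith⟩
  have hze : Even z := by
    by_contra hzo
    rw [Nat.not_even_iff_odd] at hzo
    have h1 : ((m : ZMod (m + 1))) = -1 := by
      have : ((m + 1 : ℕ) : ZMod (m + 1)) = 0 := ZMod.natCast_self _
      push_cast at this
      exact eq_neg_of_add_eq_zero_left this
    have h2 : (a : ZMod (m + 1)) = 0 := (ZMod.natCast_eq_zero_iff _ _).2 hma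
    have h3 := congrArg (Nat.cast : ℕ → ZMod (m + 1)) h
    push_cast at h3
    rw [h2, h1, zero_pow (by omega), zero_mul, zero_add, mul_neg_one, hzo.neg_pow] at h3
    have h4 : ((2 ^ (z + 1) : ℕ) : ZMod (m + 1)) = 0 := by
      push_cast
      rw [pow_succ]
      norm_num at h3
      linear_combination -h3
    have h5 := (ZMod.natCast_eq_zero_iff _ _).1 h4
    have h6 : Nat.Coprime (m + 1) (2 ^ (z + 1)) :=
      (Nat.coprime_two_right.2 hm.add_one).pow_right _
    have := Nat.Coprime.eq_one_of_dvd h6 h5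
    omega
  obtain ⟨Z, rfl⟩ := hze.two_dvd
  have hZ : 0 < Z := by omega
  have hsub : (m ^ 2 + 1) ^ 2 - (2 * m) ^ 2 = a ^ 2 := by rw [← sq_add_sq_eq ha]; simp
  have hdvd : a ^ x ∣ ((m ^ 2 + 1) ^ 2 - (2 * m) ^ 2) * Z := by
    refine dvd_sub_mul_of_dvd_pow_sub_pow hao.pow
      (by have := sq_add_sq_eq ha; have : 0 < a ^ 2 := by positivity
          omega) hZ.ne' (fun p hp hpa => ?_) ?_
    · have hpa := hp.dvd_of_dvd_pow hpa
      refine ⟨hsub ▸ dvd_pow hpa two_ne_zero, fun hc => ?_⟩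
      exact Nat.not_coprime_of_dvd_of_dvd hp.one_lt hpa (hp.dvd_of_dvd_pow hc)
        (coprime_sq_add_one hm ha)
    · rw [← pow_mul, ← pow_mul, ← h]
      simp
  obtain ⟨e, rfl⟩ : ∃ e, x = 2 + e := ⟨x - 2, by omega⟩
  rw [hsub, pow_add] at hdvd
  have h1 := Nat.le_of_dvd hZ (Nat.dvd_of_mul_dvd_mul_left (by positivity) hdvd)
  have h2 : e < a ^ e := Nat.lt_pow_self (by omega)
  omega

/-- The equation left over when `z < x = y`. -/
lemma mul_pow_add_pow_ne {m a x z R : ℕ} (hm : Even m) (hm2 : 2 ≤ m) (ha : a + 1 = m ^ 2)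
    (hm' : ∀ p, p.Prime → p ∣ m → p = 2)
    (hz : 0 < z) (hzx : z < x) :
    R * (a ^ x + (2 * m) ^ x) ≠ (m ^ 2 + 1) ^ z := by
  intro h
  have hao := odd_of_add_one_eq_sq hm ha
  have ha3 : 3 ≤ a := by nlinarith
  have hco := odd_sq_add_one hm
  have hSdvd : a ^ x + (2 * m) ^ x ∣ (m ^ 2 + 1) ^ z := Dvd.intro_left R h
  have hprime : ∀ p, p.Prime → p ∣ a ^ x + (2 * m) ^ x → p ∣ m ^ 2 + 1 :=
    fun p hp hd => hp.dvd_of_dvd_pow (hd.trans hSdvd)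
  have hp2 : ∀ p, p.Prime → p ∣ m ^ 2 + 1 → p ≠ 2 := by
    rintro p hp hd rfl
    exact Nat.not_even_iff_odd.2 hco (even_iff_two_dvd.2 hd)
  have hpa : ∀ p, p.Prime → p ∣ m ^ 2 + 1 → ¬ p ∣ a := fun p hp hc hpa =>
    Nat.not_coprime_of_dvd_of_dvd hp.one_lt hpa hc (coprime_sq_add_one hm ha)
  have hxe : Even x := by
    by_contra hx
    rw [Nat.not_even_iff_odd] at hx
    obtain ⟨p, hp, hd⟩ := Nat.exists_prime_and_dvd (show a + 2 * m ≠ 1 by omega)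
    have hpc := hprime p hp (hd.trans (hx.nat_add_dvd_pow_add_pow a (2 * m)))
    obtain ⟨r, rfl⟩ := Nat.exists_eq_add_of_le' (show 1 ≤ m by omega)
    have h1 : p ∣ 2 * r := by
      refine (Nat.dvd_add_right hpc).1 ?_
      convert hd using 1; nlinarith
    rcases hp.dvd_mul.1 h1 with h2 | h2
    · exact hp2 p hp hpc ((Nat.prime_dvd_prime_iff_eq hp Nat.prime_two).1 h2)
    · refine hpa p hp hpc (h2.trans ⟨r + 2, by nlinarith⟩)
  obtain ⟨X, rfl⟩ := hxe.two_dvd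
  have hsq := sq_add_sq_eq ha
  rw [pow_mul, pow_mul] at hSdvd h hprime
  have hS1 : 1 < (a ^ 2) ^ X + ((2 * m) ^ 2) ^ X := by
    have h1 : 0 < (a ^ 2) ^ X := by positivity
    have h2 : 0 < ((2 * m) ^ 2) ^ X := by positivity
    omega
  have hXo : Odd X := by
    by_contra hX
    rw [Nat.not_odd_iff_even] at hX
    obtain ⟨p, hp, hd⟩ := Nat.exists_prime_and_dvd hS1.ne'
    have hpc := hprime p hp hd
    have h1 : ((a : ZMod p)) ^ 2 = - (2 * m) ^ 2 := by
      have : (((m ^ 2 + 1) ^ 2 : ℕ) : ZMod p) = 0 :=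
        (ZMod.natCast_eq_zero_iff _ _).2 (dvd_pow hpc two_ne_zero)
      rw [← hsq] at this
      push_cast at this
      exact eq_neg_of_add_eq_zero_left this
    have h2 : ((2 * ((2 * m) ^ 2) ^ X : ℕ) : ZMod p) = 0 := by
      have := (ZMod.natCast_eq_zero_iff _ _).2 hd
      push_cast at this ⊢
      rw [h1, hX.neg_pow] at this
      linear_combination this
    have h3 := (ZMod.natCast_eq_zero_iff _ _).1 h2
    refine hp2 p hp hpc ?_
    rcases hp.dvd_mul.1 h3 with h4 | h4
    · exact (Nat.prime_dvd_prime_iff_eq hp Nat.prime_two).1 h4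
    · rcases hp.dvd_mul.1 (hp.dvd_of_dvd_pow (hp.dvd_of_dvd_pow h4)) with h5 | h5
      · exact (Nat.prime_dvd_prime_iff_eq hp Nat.prime_two).1 h5
      · exact hm' p hp h5
  have hdvd := dvd_add_mul_of_dvd_pow_add_pow (u := a ^ 2) (v := (2 * m) ^ 2) (n := X)
    (hco.pow.of_dvd_nat hSdvd) (by positivity) hXo
    (fun p hp hd => ⟨hsq ▸ dvd_pow (hprime p hp hd) two_ne_zero,
      fun h' => hpa p hp (hprime p hp hd) (hp.dvd_of_dvd_pow h')⟩) dvd_rfl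
  have hle := Nat.le_of_dvd (Nat.mul_pos (by positivity) hXo.pos) hdvd
  have hlt : ∀ B X : ℕ, 4 ≤ B → X + 2 < B ^ (X + 1) := by
    intro B X hB
    have h1 : X + 1 < 2 ^ (X + 1) := Nat.lt_two_pow_self
    have h2 : 2 ^ (X + 1) < B ^ (X + 1) := Nat.pow_lt_pow_left (by omega) (by omega)
    omega
  obtain ⟨q, rfl⟩ := hXo
  rcases q with _ | q
  · simp only [mul_zero, zero_add, pow_one, hsq] at h
    have hz1 : z = 1 := by omega
    subst hz1
    rw [pow_one] at h
    rcases R with _ | R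
    · simp at h
    · nlinarith [Nat.zero_le (R * (m ^ 2 + 1) ^ 2)]
  · have h1 := hlt (a ^ 2) (2 * q + 1) (by nlinarith)
    have h2 := hlt ((2 * m) ^ 2) (2 * q + 1) (by nlinarith)
    rw [show 2 * (q + 1) + 1 = (2 * q + 1 + 1) + 1 by ring, pow_succ (a ^ 2),
      pow_succ ((2 * m) ^ 2)] at hle
    have h4 : 0 < a ^ 2 := by positivity
    have h5 : 0 < (2 * m) ^ 2 := by positivity
    have h6 := Nat.mul_lt_mul_of_pos_right h1 h4
    have h7 := Nat.mul_lt_mul_of_pos_right h2 h5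
    nlinarith

/-- A factorisation `n ^ d * S = c ^ z` into coprime factors splits `c`. -/
lemma exists_mul_eq_of_pow_mul_eq_pow {n d S c z : ℕ} (hd : 0 < d) (hz : 0 < z)
    (hcop : ∀ p, p.Prime → p ∣ n → p ∣ c → ¬ p ∣ S) (h : n ^ d * S = c ^ z) :
    ∃ u v, u * v = c ∧ u ^ z = n ^ d ∧ v ^ z = S := by
  have hc : Nat.Coprime (n ^ d) S := by
    refine Nat.Coprime.pow_left d (Nat.coprime_of_dvd fun p hp hpn => hcop p hp hpn ?_)
    exact hp.dvd_of_dvd_pow (h ▸ (dvd_pow hpn hd.ne').mul_right S)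
  obtain ⟨u, hu⟩ := exists_eq_pow_of_mul_eq_pow (Nat.isUnit_iff.2 hc) h
  obtain ⟨v, hv⟩ := exists_eq_pow_of_mul_eq_pow (Nat.isUnit_iff.2 hc.symm) ((mul_comm _ _).trans h)
  refine ⟨u, v, Nat.pow_left_injective hz.ne' ?_, hu.symm, hv.symm⟩
  simp only [mul_pow, ← hu, ← hv, h]

/-- The equation left over when `z < min x y` and `x ≠ y`. -/
lemma pow_mul_ne_pow {n d S m a z : ℕ} (hn : 1 < n) (hd : 0 < d) (hm2 : 2 ≤ m)
    (ha : a + 1 = m ^ 2) (hz : 0 < z) (haS : a ^ z < S)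
    (hcop : ∀ p, p.Prime → p ∣ n → p ∣ m ^ 2 + 1 → ¬ p ∣ S) :
    n ^ d * S ≠ (m ^ 2 + 1) ^ z := by
  intro h
  obtain ⟨u, v, huv, hu, rfl⟩ := exists_mul_eq_of_pow_mul_eq_pow hd hz hcop h
  have hv : a < v := lt_of_pow_lt_pow_left₀ z (Nat.zero_le _) haS
  have hu1 : 1 < u := by
    by_contra hcon
    have h1 : u ^ z ≤ 1 := Nat.pow_le_one_iff hz.ne' |>.2 (by omega)
    have h2 : 1 < n ^ d := Nat.one_lt_pow hd.ne' hn
    omega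
  nlinarith

lemma two_ne_one_of_prime {p : ℕ} (hp : p.Prime) : (2 : ZMod p) ≠ 1 := by
  have := Fact.mk hp
  intro h
  exact one_ne_zero (α := ZMod p) (by linear_combination h)

lemma two_pow_dvd_pred_prime {p L t r z : ℕ} {v : ZMod p} (hp : p.Prime)
    (h2 : (2 : ZMod p) ^ 2 ^ L = 1) (hz : Odd z) (hv : v ≠ 0) (h : v ^ (2 ^ t * r) = 2 ^ z) :
    2 ^ (t + 1) ∣ p - 1 := by
  have := Fact.mk hp
  obtain ⟨s, q, hq, hs⟩ := Nat.exists_eq_two_pow_mul_odd (n := p - 1)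
    (by have := hp.two_le; omega)
  rw [hs]
  refine (pow_dvd_pow 2 ?_).mul_right q
  by_contra hst
  obtain ⟨e, rfl⟩ := Nat.exists_eq_add_of_le (show s ≤ t by omega)
  refine two_ne_one_of_prime hp (eq_one_of_pow_two_pow_eq_one (hz.mul hq) h2 ?_)
  rw [pow_mul, ← h, ← pow_mul, show 2 ^ (s + e) * r * q = (2 ^ s * q) * (2 ^ e * r) by ring,
    pow_mul, ← hs, ZMod.pow_card_sub_one_eq_one hv, one_pow]

lemma two_pow_dvd_sub_one_or_add_one {E : ℕ} {w : ℤ} (hw : Odd w)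
    (h : 2 ^ (E + 1) ∣ w ^ 2 - 1) : 2 ^ E ∣ w - 1 ∨ 2 ^ E ∣ w + 1 := by
  obtain ⟨r, rfl⟩ := hw
  have h4 : (2 : ℤ) ^ (E + 1) ∣ 2 * (2 * (r * (r + 1))) := by
    convert h using 1; ring
  rw [pow_succ', mul_dvd_mul_iff_left (by norm_num)] at h4
  rcases Int.even_or_odd r with hr | hr
  · left
    have hc : IsCoprime ((2 : ℤ) ^ E) (r + 1) := by
      refine IsCoprime.pow_left ?_
      obtain ⟨s, rfl⟩ := hr
      exact ⟨-s, 1, by ring⟩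
    rw [← mul_assoc] at h4
    simpa using hc.dvd_of_dvd_mul_right h4
  · right
    have hc : IsCoprime ((2 : ℤ) ^ E) r := by
      refine IsCoprime.pow_left ?_
      obtain ⟨s, rfl⟩ := hr
      exact ⟨-s, 1, by ring⟩
    rw [show (2 * r + 1 + 1 : ℤ) = 2 * (r + 1) by ring]
    exact hc.dvd_of_dvd_mul_left (by convert h4 using 1; ring)

lemma two_pow_dvd_of_dvd_pow_sub_one {v : ℤ} (hv : Odd v) (t E : ℕ)
    (h : 2 ^ (E + t) ∣ v ^ 2 ^ t - 1) : 2 ^ E ∣ v - 1 ∨ 2 ^ E ∣ v + 1 := by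
  induction t with
  | zero => left; simpa using h
  | succ t ih =>
    rcases two_pow_dvd_sub_one_or_add_one (E := E + t) (hv.pow (n := 2 ^ t))
      (by rw [← pow_mul, ← pow_succ]; exact h) with h1 | h1
    · exact ih h1
    · rcases t with _ | t
      · right; simpa using h1
      · rcases E with _ | E
        · left; simp
        · exfalso
          have h4 : (4 : ℤ) ∣ v ^ 2 ^ (t + 1) + 1 :=
            (show (4 : ℤ) ∣ 2 ^ (E + 1 + (t + 1)) from
              ⟨2 ^ (E + t), by ring⟩).trans h1
          obtain ⟨r, hr⟩ := hv.pow (n := 2 ^ t)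
          rw [pow_succ, pow_mul, hr] at h4
          obtain ⟨s, hs⟩ := h4
          ring_nf at hs
          omega

lemma pow_modEq_one_of_mul_odd {M t r v : ℕ} (hv : Odd v) (hr : Odd r)
    (h : v ^ (t * r) ≡ 1 [MOD 2 ^ (M + 1)]) : v ^ t ≡ 1 [MOD 2 ^ (M + 1)] := by
  have hc : Nat.Coprime (v ^ t) (2 ^ (M + 1)) :=
    ((Nat.coprime_two_right.2 hv).pow_right _).pow_left _
  have h1 := Nat.ModEq.pow_totient hc
  rw [Nat.totient_prime_pow_succ Nat.prime_two] at h1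
  rw [pow_mul] at h
  rw [← ZMod.natCast_eq_natCast_iff] at h h1 ⊢
  push_cast at h h1 ⊢
  exact eq_one_of_pow_two_pow_eq_one hr (by simpa using h1) h

lemma natCast_two_pow_eq_one {m a p j : ℕ} (hm : m = 2 ^ 2 ^ j) (ha : a + 1 = m ^ 2)
    (hpa : p ∣ a) : (2 : ZMod p) ^ 2 ^ (j + 1) = 1 := by
  have h1 : ((2 ^ 2 ^ (j + 1) : ℕ) : ZMod p) = ((a + 1 : ℕ) : ZMod p) := by
    rw [ha, hm, ← pow_mul, pow_succ]
  push_cast at h1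
  rw [h1, (ZMod.natCast_eq_zero_iff a p).2 hpa, zero_add]

lemma prime_le_of_dvd {m a p : ℕ} (hm : 2 ≤ m) (ha : a + 1 = m ^ 2) (hp : p.Prime) (hpa : p ∣ a) :
    p ≤ m + 1 := by
  obtain ⟨r, rfl⟩ := Nat.exists_eq_add_of_le' hm
  have h : a = (r + 1) * (r + 3) := by nlinarith
  rcases hp.dvd_mul.1 (h ▸ hpa) with h1 | h1
  · have := Nat.le_of_dvd (by omega) h1; omega
  · have := Nat.le_of_dvd (by omega) h1; omega

/-- No factorisation of `m ^ 2 - 1` has a nontrivial factor `±1` modulo `2 m`. -/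
lemma eq_one_of_modEq_sq_sub_one {m a u v : ℕ} (hme : Even m) (hm2 : 2 ≤ m)
    (ha : a + 1 = m ^ 2) (huv : u * v = a) (hu : 1 < u)
    (h : (2 * m : ℤ) ∣ v - 1 ∨ (2 * m : ℤ) ∣ v + 1) : v = 1 := by
  by_contra hv1
  obtain ⟨m', rfl⟩ := hme.two_dvd
  have hv0 : v ≠ 0 := by rintro rfl; simp at huv; nlinarith
  have huvZ : (u : ℤ) * v = 4 * m' ^ 2 - 1 := by
    have : ((u * v + 1 : ℕ) : ℤ) = (((2 * m') ^ 2 : ℕ) : ℤ) := by rw [huv, ha]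
    push_cast at this
    linear_combination this
  have hbound : (2 * (2 * m') : ℤ) ≤ v + 1 ∧ (2 * (2 * m') : ℤ) ≤ u + 1 := by
    push_cast at h
    rcases h with h | h
    · have h1 : (2 * (2 * m') : ℤ) ∣ u + 1 := by
        rw [show (u : ℤ) + 1 = m' * (2 * (2 * m')) - u * (v - 1) by linear_combination huvZ]
        exact dvd_sub (dvd_mul_left _ _) (h.mul_left _)
      have h2 := Int.le_of_dvd (by omega) h
      have h3 := Int.le_of_dvd (by omega) h1
      omega
    · have h1 : (2 * (2 * m') : ℤ) ∣ u - 1 := by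
        rw [show (u : ℤ) - 1 = u * (v + 1) - m' * (2 * (2 * m')) by linear_combination -huvZ]
        exact dvd_sub (h.mul_left _) (dvd_mul_left _ _)
      have h2 := Int.le_of_dvd (by omega) h
      have h3 := Int.le_of_dvd (by omega) h1
      omega
  have hm1 : (1 : ℤ) ≤ m' := by omega
  nlinarith [mul_le_mul hbound.1 hbound.2 (by positivity) (by positivity)]

/-- The equation left over when `x < z < y`. -/
lemma pow_add_pow_mul_ne {j m a u v n x y z d : ℕ} (hm : m = 2 ^ 2 ^ j) (ha : a + 1 = m ^ 2)
    (huv : u * v = a) (hu : 1 < u) (hun : ∀ p, p.Prime → p ∣ u → p ∣ n) (hn : 0 < n)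
    (hx : 0 < x) (hxz : x < z) (hzy : z < y) (hd : 0 < d) :
    v ^ x + (2 * m) ^ y * n ^ d ≠ (m ^ 2 + 1) ^ z := by
  intro h
  have hM : 0 < 2 ^ j := by positivity
  have hm2 : 2 ≤ m := hm ▸ Nat.le_self_pow hM.ne' 2
  have hme : Even m := hm ▸ (even_two.pow_of_ne_zero hM.ne')
  have hao := odd_of_add_one_eq_sq hme ha
  have hvo : Odd v := hao.of_dvd_nat (Dvd.intro_left u huv)
  have hmm : m ^ 2 = 2 ^ (2 * 2 ^ j - 1 + 1) := by
    rw [hm, ← pow_mul]; congr 1; omega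
  have hv1 : v ^ x ≡ 1 [MOD m ^ 2] := by
    have h1 : m ^ 2 ∣ (2 * m) ^ y * n ^ d :=
      ((pow_dvd_pow_of_dvd (dvd_mul_left m 2) 2).trans (pow_dvd_pow _ (by omega))).mul_right _
    have h2 : (m ^ 2 + 1) ^ z ≡ 1 [MOD m ^ 2] := by
      have : m ^ 2 + 1 ≡ 1 [MOD m ^ 2] := by simp [Nat.ModEq]
      simpa using this.pow z
    rw [← h] at h2
    exact (((Nat.modEq_zero_iff_dvd.2 h1).add_left (v ^ x)).symm.trans h2)
  have hze : Even z := by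
    by_contra hzo
    rw [Nat.not_even_iff_odd] at hzo
    obtain ⟨p, hp, hpu⟩ := Nat.exists_prime_and_dvd hu.ne'
    have hpa : p ∣ a := huv ▸ hpu.mul_right v
    have h2 := natCast_two_pow_eq_one hm ha hpa
    have hvz : (v : ZMod p) ^ x = 2 ^ z := by
      have h3 := congrArg (Nat.cast : ℕ → ZMod p) h
      have h4 := (ZMod.natCast_eq_zero_iff a p).2 hpa
      have h5 := (ZMod.natCast_eq_zero_iff n p).2 (hun p hp hpu)
      rw [← ha] at h3
      push_cast at h3
      rw [h4, h5, zero_pow hd.ne'] at h3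
      norm_num at h3
      exact h3
    obtain ⟨t, r, hr, rfl⟩ := Nat.exists_eq_two_pow_mul_odd hx.ne'
    have hv0 : (v : ZMod p) ≠ 0 := by
      intro h0
      have := Fact.mk hp
      rw [h0, zero_pow hx.ne'] at hvz
      have h20 : (2 : ZMod p) = 0 := eq_zero_of_pow_eq_zero hvz.symm
      rw [h20, zero_pow (by positivity)] at h2
      exact zero_ne_one h2
    have h6 := Nat.le_of_dvd (by have := hp.two_le; omega)
      (two_pow_dvd_pred_prime hp h2 hzo hv0 hvz)
    have h7 : 2 ^ (t + 1) ≤ 2 ^ 2 ^ j := by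
      have := prime_le_of_dvd hm2 ha hp hpa
      omega
    have h8 : t + 1 ≤ 2 ^ j := (Nat.pow_le_pow_iff_right (by norm_num)).1 h7
    rw [hmm] at hv1
    have h9 := (Nat.modEq_iff_dvd.1 (pow_modEq_one_of_mul_odd hvo hr hv1).symm)
    push_cast at h9
    have h10 : v = 1 := by
      refine eq_one_of_modEq_sq_sub_one hme hm2 ha huv hu ?_
      have h11 : (2 * m : ℤ) = 2 ^ (2 ^ j + 1) := by rw [hm]; push_cast; ring
      rw [h11]
      refine two_pow_dvd_of_dvd_pow_sub_one (by exact_mod_cast hvo) t _ ?_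
      exact (pow_dvd_pow 2 (by omega)).trans h9
    rw [h10, Nat.cast_one, one_pow] at hvz
    exact two_ne_one_of_prime hp (eq_one_of_pow_two_pow_eq_one hzo h2 hvz.symm)
  obtain ⟨Z, rfl⟩ := hze.two_dvd
  obtain ⟨w, hwo, hw⟩ : ∃ w, Odd w ∧ v ^ x = w ^ 2 := by
    rcases Nat.even_or_odd x with hxe | hxo
    · obtain ⟨X, rfl⟩ := hxe.two_dvd
      exact ⟨v ^ X, hvo.pow, by rw [mul_comm, pow_mul]⟩
    · refine ⟨1, odd_one, ?_⟩
      have h1 : v ^ 1 ≡ 1 [MOD m ^ 2] := by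
        rw [hmm] at hv1 ⊢
        exact pow_modEq_one_of_mul_odd hvo hxo (by simpa using hv1)
      have h2 : v < m ^ 2 := by nlinarith [hvo.pos]
      rw [pow_one] at h1
      rw [Nat.ModEq.eq_of_lt_of_lt h1 h2 (by nlinarith)]
      simp
  exact square_add_mul_ne hM hm hwo (N := n ^ d) (by positivity) (by omega) hzy (hw ▸ h)

lemma three_dvd_of_add_one_eq_sq {m a M : ℕ} (hm : m = 2 ^ M) (ha : a + 1 = m ^ 2) : 3 ∣ a := by
  have h1 : ¬ 3 ∣ m := fun h => by
    have := Nat.prime_three.dvd_of_dvd_pow (hm ▸ h)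
    omega
  have h2 : m ^ 2 % 3 = 1 := by
    rw [Nat.pow_mod]
    have : m % 3 = 1 ∨ m % 3 = 2 := by omega
    rcases this with h | h <;> simp [h]
  omega

lemma even_left_exponent {m a x y z N : ℕ} (hm : Even m) (ha : a + 1 = m ^ 2) (hy : 0 < y)
    (h : a ^ x + (2 * m) ^ y * N = (m ^ 2 + 1) ^ z) : Even x := by
  by_contra hx
  rw [Nat.not_even_iff_odd] at hx
  obtain ⟨r, rfl⟩ := hm.two_dvd
  have h4 : (4 : ZMod 4) = 0 := rfl
  have h1 : (a : ZMod 4) = -1 := by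
    have := congrArg (Nat.cast : ℕ → ZMod 4) ha
    push_cast at this
    linear_combination this + r ^ 2 * h4
  have h2 := congrArg (Nat.cast : ℕ → ZMod 4) h
  push_cast at h2
  rw [h1, hx.neg_one_pow, show (2 * (2 * r) : ZMod 4) = 0 by linear_combination r * h4,
    show ((2 * r) ^ 2 + 1 : ZMod 4) = 1 by linear_combination r ^ 2 * h4, zero_pow hy.ne'] at h2
  simp at h2
  exact absurd h2 (by decide)

/-- Parity of `y` from the order of `2` modulo the Fermat number `m ^ 2 + 1`. -/
lemma even_middle_exponent {j m a x y z : ℕ} (hj : 0 < j) (hm : m = 2 ^ 2 ^ j)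
    (ha : a + 1 = m ^ 2) (hz : 0 < z) (hx : Even x)
    (h : a ^ x + (2 * m) ^ y = (m ^ 2 + 1) ^ z) : Even y := by
  by_contra hy
  rw [Nat.not_even_iff_odd] at hy
  have hc : (m : ZMod (m ^ 2 + 1)) ^ 2 = -1 := by
    have : ((m ^ 2 + 1 : ℕ) : ZMod (m ^ 2 + 1)) = 0 := ZMod.natCast_self _
    push_cast at this
    exact eq_neg_of_add_eq_zero_left this
  have hma : (a : ZMod (m ^ 2 + 1)) = -2 := by
    have := congrArg (Nat.cast : ℕ → ZMod (m ^ 2 + 1)) ha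
    push_cast at this
    linear_combination this + hc
  have hm' : (m : ZMod (m ^ 2 + 1)) = 2 ^ 2 ^ j := by
    have := congrArg (Nat.cast : ℕ → ZMod (m ^ 2 + 1)) hm
    simpa using this
  have h1 := congrArg (Nat.cast : ℕ → ZMod (m ^ 2 + 1)) h
  push_cast at h1
  rw [hma, hc, hx.neg_pow, neg_add_cancel, zero_pow hz.ne', hm', ← pow_succ'] at h1
  have h4 : (2 : ZMod (m ^ 2 + 1)) ^ (2 ^ j * 4) = 1 := by
    rw [pow_mul, ← hm', show 4 = 2 * 2 from rfl, pow_mul, hc]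
    norm_num
  have hodd : Odd ((2 ^ j + 1) * y + (2 ^ j * 4 - 1) * x) := by
    have h2 : Even (2 ^ j) := even_two.pow_of_ne_zero hj.ne'
    exact (h2.add_one.mul hy).add_even (hx.mul_left _)
  have h5 : ((2 : ZMod (m ^ 2 + 1)) ^ 2) ^ 2 ^ (j + 1) = 1 := by
    rw [← pow_mul, show 2 * 2 ^ (j + 1) = 2 ^ j * 4 by ring, h4]
  have h6 : ((2 : ZMod (m ^ 2 + 1)) ^ 2) ^ ((2 ^ j + 1) * y + (2 ^ j * 4 - 1) * x) = 1 := by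
    have hneg : (2 : ZMod (m ^ 2 + 1)) ^ ((2 ^ j + 1) * y + (2 ^ j * 4 - 1) * x) = -1 := by
      rw [pow_add, pow_mul 2 (2 ^ j + 1) y, eq_neg_of_add_eq_zero_right h1, neg_mul, ← pow_add]
      congr 1
      have h7 : x + (2 ^ j * 4 - 1) * x = 2 ^ j * 4 * x := by
        have : 0 < 2 ^ j := by positivity
        obtain ⟨s, hs⟩ := Nat.exists_eq_add_of_le' (show 1 ≤ 2 ^ j * 4 by omega)
        rw [hs, Nat.add_sub_cancel]; ring
      rw [h7, pow_mul, h4, one_pow]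
    rw [pow_right_comm, hneg]; norm_num
  have h7 := eq_one_of_pow_two_pow_eq_one hodd h5 h6
  have h8 : ((3 : ℕ) : ZMod (m ^ 2 + 1)) = 0 := by
    push_cast
    linear_combination h7
  have h9 := Nat.le_of_dvd (by norm_num) ((ZMod.natCast_eq_zero_iff _ _).1 h8)
  have h10 : 2 ≤ m := hm ▸ Nat.le_self_pow (by positivity) 2
  nlinarith

/-- The primitive equation. -/
lemma exponents_eq_two_of_primitive {j m a x y z : ℕ} (hm : m = 2 ^ 2 ^ j) (ha : a + 1 = m ^ 2)
    (hx : 0 < x) (hy : 0 < y) (hz : 0 < z) (h : a ^ x + (2 * m) ^ y = (m ^ 2 + 1) ^ z) :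
    x = 2 ∧ y = 2 ∧ z = 2 := by
  have hM : 0 < 2 ^ j := by positivity
  have hm2 : 2 ≤ m := hm ▸ Nat.le_self_pow hM.ne' 2
  have hme : Even m := hm ▸ (even_two.pow_of_ne_zero hM.ne')
  have h3 := three_dvd_of_add_one_eq_sq hm ha
  have hxe : Even x := even_left_exponent (N := 1) hme ha hy (by rwa [mul_one])
  have hmod : (2 * m) ^ y ≡ 2 ^ z [MOD 3] := by
    have h1 := (((sq_add_one_modEq_two ha).of_dvd h3).pow z)
    rw [← h] at h1
    refine Nat.ModEq.trans ?_ h1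
    simpa using ((Nat.modEq_zero_iff_dvd.2 (h3.trans (dvd_pow_self a hx.ne'))).add_right
      ((2 * m) ^ y)).symm
  have hze : Even z := by
    refine even_of_two_pow_modEq_one (hmod.symm.trans ?_)
    have hsq : (2 * m) ^ 2 ≡ 1 [MOD 3] := by
      rw [mul_pow, ← ha]
      unfold Nat.ModEq
      omega
    rcases Nat.eq_zero_or_pos j with rfl | hj
    · simp only [hm, pow_zero, pow_one]
      simpa using (show 2 * 2 ≡ 1 [MOD 3] from rfl).pow y
    · obtain ⟨Y, rfl⟩ := (even_middle_exponent hj hm ha hz hxe h).two_dvd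
      rw [pow_mul]
      simpa using hsq.pow Y
  obtain ⟨X, rfl⟩ := hxe.two_dvd
  obtain ⟨Z, rfl⟩ := hze.two_dvd
  have hpow : (2 * m) ^ y = 2 ^ ((2 ^ j + 1) * y) := by rw [hm, pow_mul, pow_succ']
  obtain ⟨rfl, rfl⟩ := sq_add_two_pow_eq_sq hM hm ha h3 (by omega) (hpow ▸ h)
  refine ⟨rfl, ?_, rfl⟩
  rw [mul_one, ← sq_add_sq_eq ha] at h
  exact Nat.pow_right_injective (show 2 ≤ 2 * m by omega) (Nat.add_left_cancel h)

lemma exponents_eq_two_of_le {A B C x y z : ℕ} (hA : 2 ≤ A) (hB : 2 ≤ B)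
    (hABC : A ^ 2 + B ^ 2 = C ^ 2) (hx : 0 < x) (hy : 0 < y) (hxz : x ≤ z) (hyz : y ≤ z)
    (h : A ^ x + B ^ y = C ^ z) : x = 2 ∧ y = 2 ∧ z = 2 := by
  have hAC : A < C := lt_of_pow_lt_pow_left₀ 2 (Nat.zero_le _) (by nlinarith)
  have hBC : B < C := lt_of_pow_lt_pow_left₀ 2 (Nat.zero_le _) (by nlinarith)
  rcases Nat.lt_or_ge z 2 with hz | hz
  · obtain rfl : x = 1 := by omega
    obtain rfl : y = 1 := by omega
    obtain rfl : z = 1 := by omega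
    nlinarith
  obtain ⟨e, rfl⟩ := Nat.exists_eq_add_of_le' hz
  have h1 : A ^ x ≤ A ^ e * A ^ 2 :=
    pow_add A e 2 ▸ Nat.pow_le_pow_right (by omega) hxz
  have h2 : B ^ y ≤ B ^ e * B ^ 2 :=
    pow_add B e 2 ▸ Nat.pow_le_pow_right (by omega) hyz
  rw [pow_add, ← hABC] at h
  rcases Nat.eq_zero_or_pos e with rfl | he
  · simp only [pow_zero, one_mul] at h h1 h2
    exact ⟨Nat.pow_right_injective hA (show A ^ x = A ^ 2 by omega),
      Nat.pow_right_injective hB (show B ^ y = B ^ 2 by omega), rfl⟩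
  · have h3 := Nat.mul_lt_mul_of_pos_right (Nat.pow_lt_pow_left hAC he.ne')
      (show 0 < A ^ 2 by positivity)
    have h4 := Nat.mul_lt_mul_of_pos_right (Nat.pow_lt_pow_left hBC he.ne')
      (show 0 < B ^ 2 by positivity)
    nlinarith

/-- Jeśmanowicz' conjecture for `(m ^ 2 - 1, 2 m, m ^ 2 + 1)` with `m = 2 ^ 2 ^ j`. -/
lemma exponents_eq_two {j m a n x y z : ℕ} (hm : m = 2 ^ 2 ^ j) (ha : a + 1 = m ^ 2)
    (hn : 0 < n) (hx : 0 < x) (hy : 0 < y) (hz : 0 < z)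
    (h : (a * n) ^ x + (2 * m * n) ^ y = ((m ^ 2 + 1) * n) ^ z) : x = 2 ∧ y = 2 ∧ z = 2 := by
  have hM : 0 < 2 ^ j := by positivity
  have hm2 : 2 ≤ m := hm ▸ Nat.le_self_pow hM.ne' 2
  have hme : Even m := hm ▸ (even_two.pow_of_ne_zero hM.ne')
  have hao := odd_of_add_one_eq_sq hme ha
  have ha3 : 3 ≤ a := by nlinarith
  have h3 := three_dvd_of_add_one_eq_sq hm ha
  have hco := odd_sq_add_one hme
  have hm' : ∀ p, p.Prime → p ∣ m → p = 2 := fun p hp hd =>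
    (Nat.prime_dvd_prime_iff_eq hp Nat.prime_two).1 (hp.dvd_of_dvd_pow (hm ▸ hd))
  have hac : ∀ p, p.Prime → p ∣ m ^ 2 + 1 → ¬ p ∣ a := fun p hp hc hpa =>
    Nat.not_coprime_of_dvd_of_dvd hp.one_lt hpa hc (coprime_sq_add_one hme ha)
  have hbc : ∀ p, p.Prime → p ∣ m ^ 2 + 1 → ¬ p ∣ 2 * m := fun p hp hc hpb => by
    have hp2 : p = 2 := (hp.dvd_mul.1 hpb).elim
      (Nat.prime_dvd_prime_iff_eq hp Nat.prime_two).1 (hm' p hp)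
    exact Nat.not_even_iff_odd.2 hco (even_iff_two_dvd.2 (hp2 ▸ hc))
  rcases (Nat.succ_le_of_lt hn).eq_or_lt' with rfl | hn1
  · exact exponents_eq_two_of_primitive hm ha hx hy hz (by simpa using h)
  rcases Nat.lt_or_ge z x with hzx | hxz
  · exfalso
    rcases lt_trichotomy y z with hyz | rfl | hzy
    · obtain ⟨d, rfl⟩ := Nat.exists_eq_add_of_lt hyz
      obtain ⟨e, rfl⟩ := Nat.exists_eq_add_of_lt hzx
      have h1 : n ^ (d + 1) * (a ^ (y + d + 1 + e + 1) * n ^ (e + 1)) + (2 * m) ^ y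
          = n ^ (d + 1) * (m ^ 2 + 1) ^ (y + d + 1) := by
        refine Nat.eq_of_mul_eq_mul_left (show 0 < n ^ y by positivity) ?_
        rw [mul_pow a, mul_pow (2 * m), mul_pow (m ^ 2 + 1)] at h
        linear_combination h
      obtain ⟨Q, hQ⟩ : n ^ (d + 1) ∣ (2 * m) ^ y :=
        (Nat.dvd_add_right (dvd_mul_right _ _)).1 (h1 ▸ dvd_mul_right _ _)
      rw [hQ, ← mul_add] at h1
      have h2 := Nat.eq_of_mul_eq_mul_left (by positivity) h1
      have hne : Even n := by
        obtain ⟨p, hp, hpn⟩ := Nat.exists_prime_and_dvd hn1.ne'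
        have h4 : p ∣ 2 * m :=
          hp.dvd_of_dvd_pow (hQ ▸ (dvd_pow hpn (by omega)).mul_right Q)
        have hp2 : p = 2 := (hp.dvd_mul.1 h4).elim
          (Nat.prime_dvd_prime_iff_eq hp Nat.prime_two).1 (hm' p hp)
        exact even_iff_two_dvd.2 (hp2 ▸ hpn)
      have hQo : Odd Q := by
        have h4 : Even (a ^ (y + d + 1 + e + 1) * n ^ (e + 1)) :=
          (hne.pow_of_ne_zero (by omega)).mul_left _
        by_contra hQe
        have h5 := h4.add (Nat.not_odd_iff_even.1 hQe)
        rw [h2] at h5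
        exact Nat.not_even_iff_odd.2 hco.pow h5
      have hpow : (2 * m) ^ y = 2 ^ ((2 ^ j + 1) * y) := by rw [hm, pow_mul, pow_succ']
      have hQ1 : Q = 1 := by
        refine Nat.Coprime.eq_one_of_dvd ((Nat.coprime_two_right.2 hQo).pow_right _)
          (hpow ▸ hQ ▸ dvd_mul_left Q _)
      exact mul_pow_add_one_ne ha h3 hz hzx (hQ1 ▸ h2)
    · obtain ⟨d, rfl⟩ := Nat.exists_eq_add_of_lt hzx
      refine pow_mul_add_pow_ne (R := n ^ (d + 1)) hme hm2 ha hz hzx ?_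
      refine Nat.eq_of_mul_eq_mul_left (show 0 < n ^ y by positivity) ?_
      rw [mul_pow a, mul_pow (2 * m), mul_pow (m ^ 2 + 1)] at h
      linear_combination h
    · rcases lt_trichotomy x y with hxy | rfl | hyx
      · obtain ⟨d, rfl⟩ := Nat.exists_eq_add_of_lt hzx
        obtain ⟨e, rfl⟩ := Nat.exists_eq_add_of_lt hxy
        refine pow_mul_ne_pow hn1 (d := d + 1) (show 0 < d + 1 by omega)
          (S := a ^ (z + d + 1) + (2 * m) ^ (z + d + 1 + e + 1) * n ^ (e + 1)) hm2 ha hz ?_ ?_ ?_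
        · exact (Nat.pow_lt_pow_right (by omega) hzx).trans_le (Nat.le_add_right _ _)
        · intro p hp hpn hpc hd
          refine hac p hp hpc (hp.dvd_of_dvd_pow ((Nat.dvd_add_left ?_).1 hd))
          exact (dvd_pow hpn (by omega)).mul_left _
        · refine Nat.eq_of_mul_eq_mul_left (show 0 < n ^ z by positivity) ?_
          rw [mul_pow a, mul_pow (2 * m), mul_pow (m ^ 2 + 1)] at h
          linear_combination h
      · obtain ⟨d, rfl⟩ := Nat.exists_eq_add_of_lt hzx
        refine mul_pow_add_pow_ne (R := n ^ (d + 1)) hme hm2 ha hm' hz hzx ?_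
        refine Nat.eq_of_mul_eq_mul_left (show 0 < n ^ z by positivity) ?_
        rw [mul_pow a, mul_pow (2 * m), mul_pow (m ^ 2 + 1)] at h
        linear_combination h
      · obtain ⟨d, rfl⟩ := Nat.exists_eq_add_of_lt hzy
        obtain ⟨e, rfl⟩ := Nat.exists_eq_add_of_lt hyx
        refine pow_mul_ne_pow hn1 (d := d + 1) (show 0 < d + 1 by omega)
          (S := (2 * m) ^ (z + d + 1) + a ^ (z + d + 1 + e + 1) * n ^ (e + 1)) hm2 ha hz ?_ ?_ ?_
        · refine (Nat.pow_lt_pow_right (by omega) hzx).trans_le ((Nat.le_add_left _ _).trans' ?_)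
          exact Nat.le_mul_of_pos_right _ (by positivity)
        · intro p hp hpn hpc hd
          refine hbc p hp hpc (hp.dvd_of_dvd_pow ((Nat.dvd_add_left ?_).1 hd))
          exact (dvd_pow hpn (by omega)).mul_left _
        · refine Nat.eq_of_mul_eq_mul_left (show 0 < n ^ z by positivity) ?_
          rw [mul_pow a, mul_pow (2 * m), mul_pow (m ^ 2 + 1)] at h
          linear_combination h
  rcases Nat.lt_or_ge z y with hzy | hyz
  · exfalso
    obtain ⟨e, rfl⟩ := Nat.exists_eq_add_of_lt hzy
    rcases hxz.eq_or_lt with rfl | hxz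
    · have h1 : a ^ x + (2 * m) ^ (x + e + 1) * n ^ (e + 1) = (m ^ 2 + 1) ^ x := by
        refine Nat.eq_of_mul_eq_mul_left (show 0 < n ^ x by positivity) ?_
        rw [mul_pow a, mul_pow (2 * m), mul_pow (m ^ 2 + 1)] at h
        linear_combination h
      obtain ⟨X, rfl⟩ := (even_left_exponent hme ha hy h1).two_dvd
      refine square_add_mul_ne (y := 2 * X + e + 1) hM hm (hao.pow (n := X))
        (show 0 < n ^ (e + 1) by positivity) (by omega) hzy ?_
      rw [← h1, ← pow_mul, mul_comm X 2]
    · obtain ⟨d, rfl⟩ := Nat.exists_eq_add_of_lt hxz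
      have h1 : a ^ x + n ^ (d + 1) * ((2 * m) ^ (x + d + 1 + e + 1) * n ^ (e + 1))
          = n ^ (d + 1) * (m ^ 2 + 1) ^ (x + d + 1) := by
        refine Nat.eq_of_mul_eq_mul_left (show 0 < n ^ x by positivity) ?_
        rw [mul_pow a, mul_pow (2 * m), mul_pow (m ^ 2 + 1)] at h
        linear_combination h
      obtain ⟨Q, hQ⟩ : n ^ (d + 1) ∣ a ^ x :=
        (Nat.dvd_add_left (dvd_mul_right _ _)).1 (h1 ▸ dvd_mul_right _ _)
      rw [hQ, ← mul_add] at h1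
      have h2 := Nat.eq_of_mul_eq_mul_left (by positivity) h1
      obtain ⟨u, v, huv, hu, rfl⟩ := exists_mul_eq_of_pow_mul_eq_pow (show 0 < d + 1 by omega) hx
        (fun p hp hpn hpa hpQ => by
          refine hac p hp (hp.dvd_of_dvd_pow (n := x + d + 1) (h2 ▸ ?_)) hpa
          exact dvd_add hpQ ((dvd_pow hpn (by omega)).mul_left _)) hQ.symm
      have hu1 : 1 < u := by
        by_contra hcon
        have h4 : u ^ x ≤ 1 := (Nat.pow_le_one_iff hx.ne').2 (by omega)
        have h5 : 1 < n ^ (d + 1) := Nat.one_lt_pow (by omega) hn1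
        exact absurd hu (by omega)
      refine pow_add_pow_mul_ne hm ha huv hu1 (fun p hp hpu => ?_) hn hx hxz hzy
        (show 0 < e + 1 by omega) h2
      exact hp.dvd_of_dvd_pow (hu ▸ dvd_pow hpu hx.ne')
  · have hABC : (a * n) ^ 2 + (2 * m * n) ^ 2 = ((m ^ 2 + 1) * n) ^ 2 := by
      rw [mul_pow, mul_pow _ n, mul_pow _ n, ← sq_add_sq_eq ha]; ring
    exact exponents_eq_two_of_le (by nlinarith) (by nlinarith) hABC hx hy hxz hyz h

theorem stmt18 (k n x y z : ℕ) (hk : 1 ≤ k) (hn : 0 < n)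
    (hx : 0 < x) (hy : 0 < y) (hz : 0 < z)
    (h : ((2 ^ 2 ^ k + 1 - 2) * n) ^ x + (2 ^ (2 ^ (k - 1) + 1) * n) ^ y
        = ((2 ^ 2 ^ k + 1) * n) ^ z) :
    x = 2 ∧ y = 2 ∧ z = 2 := by
  obtain ⟨j, rfl⟩ := Nat.exists_eq_add_of_le' hk
  have hsq : 2 ^ 2 ^ (j + 1) = (2 ^ 2 ^ j) ^ 2 := by rw [← pow_mul, pow_succ]
  have hpos : 0 < (2 ^ 2 ^ j) ^ 2 := by positivity
  rw [Nat.add_sub_cancel, pow_succ' 2 (2 ^ j), hsq] at h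
  exact exponents_eq_two rfl (by omega) hn hx hy hz h
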